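/- For all alternating maps A ∈ A^a(V), B ∈ A^b(V) and every first-order multidifferential operator C ∈ ADiff_1^c(V) one has i_{A∧B}C = (−1)^{c(b+1)}(i_A C)∧B + A∧(i_B C) − A∧B∧(i_1 C), where i_1 C = C(1,·,…,·). -/

import Mathlib

/-!  Common framework: operations of degree `a ≥ -1` on a vector space `V`
(i.e. `(a+1)`-linear maps `V^{a+1} → V`) are encoded as raw functions
`(ℕ → V) → V` depending only on the first `a+1` entries of the argument
sequence, together with explicit multilinearity/alternation predicates. -/

noncomputable section
open scoped Classical

namespace JacobiRevisited

/-- Raw operations on `V`: an `n`-ary operation is encoded by its action on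
infinite sequences of arguments (using only the first `n` of them). -/
abbrev Op (V : Type*) := (ℕ → V) → V

/-- `A` depends only on the first `n` arguments. -/
def DependsOn {V : Type*} (n : ℕ) (A : Op V) : Prop :=
  ∀ x y : ℕ → V, (∀ i, i < n → x i = y i) → A x = A y

/-- `A` is an `n`-linear map `V^n → V` (encoded on sequences): it depends only on
the first `n` arguments and is `k`-linear in each of them. -/
def IsMultilinearOn (k : Type*) {V : Type*} [Semiring k] [AddCommMonoid V]
    [Module k V] (n : ℕ) (A : Op V) : Prop :=
  DependsOn n A ∧
    ∀ i, i < n →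
      (∀ (x : ℕ → V) (c : k) (v : V),
        A (Function.update x i (c • v)) = c • A (Function.update x i v)) ∧
      (∀ (x : ℕ → V) (v w : V),
        A (Function.update x i (v + w)) =
          A (Function.update x i v) + A (Function.update x i w))

/-- `A` is alternating in its first `n` arguments. -/
def IsAlternatingOn {V : Type*} [Zero V] (n : ℕ) (A : Op V) : Prop :=
  ∀ x : ℕ → V, ∀ i j, i < n → j < n → i ≠ j → x i = x j → A x = 0

/-- The number of arguments of an operation of degree `a` (namely `a+1`). -/
def ar (a : ℤ) : ℕ := (a + 1).toNat

/-- Membership in `M^a(V)`: an `(a+1)`-linear map `V^{a+1} → V`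
(for `a = -1` this is just a constant, i.e. an element of `V`). -/
def MemM (k : Type*) {V : Type*} [Semiring k] [AddCommMonoid V] [Module k V]
    (a : ℤ) (A : Op V) : Prop := IsMultilinearOn k (ar a) A

/-- Membership in `A^a(V)`: an alternating `(a+1)`-linear map `V^{a+1} → V`. -/
def MemA (k : Type*) {V : Type*} [Semiring k] [AddCommMonoid V] [Module k V]
    (a : ℤ) (A : Op V) : Prop :=
  IsMultilinearOn k (ar a) A ∧ IsAlternatingOn (ar a) A

/-- The argument sequence `x_0, …, x_{m-1}, B(x_m,…,x_{m+nB-1}), x_{m+nB}, …`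
(arguments for the outer operation after inserting the `nB`-ary `B`
at slot `m`). -/
def insertArg {V : Type*} (B : Op V) (nB m : ℕ) (x : ℕ → V) : ℕ → V := fun j =>
  if j < m then x j
  else if j = m then B fun i => x (m + i)
  else x (j + nB - 1)

/-- The Gerstenhaber insertion `ι_B A` of `B ∈ M^b(V)` into `A ∈ M^a(V)`:
`ι_B A(x_0,…,x_{a+b}) = Σ_{m=0}^{a} (−1)^{b·m} A(x_0,…,x_{m−1},
B(x_m,…,x_{m+b}), x_{m+b+1},…,x_{a+b})`. -/
def gIns {V : Type*} [AddCommGroup V] (a b : ℤ) (A B : Op V) : Op V := fun x =>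
  ∑ m ∈ Finset.range (ar a),
    (((-1 : ℤˣ) ^ (b * (m : ℤ)) : ℤˣ) : ℤ) • A (insertArg B (ar b) m x)

/-- The Gerstenhaber bracket `[A,B]^G = −ι_A B + (−1)^{ab} ι_B A` of
`A ∈ M^a(V)` and `B ∈ M^b(V)`. -/
def gBracket {V : Type*} [AddCommGroup V] (a b : ℤ) (A B : Op V) : Op V :=
  -(gIns b a B A) + (((-1 : ℤˣ) ^ (a * b) : ℤˣ) : ℤ) • gIns a b A B

/-- The set `S(n-1, p-1)` of unshuffle permutations of `{0,…,n-1}` which are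
strictly increasing on the first `p` positions and on the remaining ones. -/
def Unshuffles (n p : ℕ) : Finset (Equiv.Perm (Fin n)) :=
  Finset.univ.filter fun σ =>
    (∀ i j : Fin n, (i : ℕ) < (j : ℕ) → (j : ℕ) < p → σ i < σ j) ∧
    (∀ i j : Fin n, (i : ℕ) < (j : ℕ) → p ≤ (i : ℕ) → σ i < σ j)

/-- The Nijenhuis–Richardson insertion `i_B A` of the `nB`-ary `B` into the
`nA`-ary `A`:
`i_B A(x_0,…,x_{a+b}) = Σ_{σ ∈ S(a+b,b)} sgn(σ) ·
A(B(x_{σ(0)},…,x_{σ(b)}), x_{σ(b+1)},…,x_{σ(a+b)})`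
(and `i_B A = 0` when `A` has degree `-1`, i.e. no argument slots). -/
def nrIns {V : Type*} [AddCommGroup V] (nA nB : ℕ) (A B : Op V) : Op V := fun x =>
  if hA : nA = 0 then 0
  else
    ∑ σ ∈ Unshuffles (nA + nB - 1) nB,
      ((Equiv.Perm.sign σ : ℤˣ) : ℤ) •
        A fun j =>
          if hj0 : j = 0 then
            B fun i => if hi : i < nB then x (σ ⟨i, by omega⟩) else 0
          else if hj : j < nA then x (σ ⟨nB + j - 1, by omega⟩) else 0

/-- The Nijenhuis–Richardson bracket `[A,B]^{NR} = −i_A B + (−1)^{ab} i_B A`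
of `A ∈ A^a(V)` and `B ∈ A^b(V)`. -/
def nrBracket {V : Type*} [AddCommGroup V] (a b : ℤ) (A B : Op V) : Op V :=
  -(nrIns (ar b) (ar a) B A) +
    (((-1 : ℤˣ) ^ (a * b) : ℤˣ) : ℤ) • nrIns (ar a) (ar b) A B

/-- The wedge product `A∧B` of the `nA`-ary `A` and the `nB`-ary `B`
(over a commutative algebra `V`):
`(A∧B)(x_0,…,x_{a+b+1}) = Σ_σ sgn(σ) · A(x_{σ(0)},…,x_{σ(a)}) ·
B(x_{σ(a+1)},…,x_{σ(a+b+1)})` summed over unshuffles. -/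
def wedge {V : Type*} [CommRing V] (nA nB : ℕ) (A B : Op V) : Op V := fun x =>
  ∑ σ ∈ Unshuffles (nA + nB) nA,
    ((Equiv.Perm.sign σ : ℤˣ) : ℤ) •
      (A (fun i => if hi : i < nA then x (σ ⟨i, by omega⟩) else 0) *
        B fun j => if hj : j < nB then x (σ ⟨nA + j, by omega⟩) else 0)

/-- The argument sequence `v, x_0, x_1, …`. -/
def consV {V : Type*} (v : V) (x : ℕ → V) : ℕ → V := fun n =>
  if n = 0 then v else x (n - 1)

/-- The argument sequence `v, w, 0, 0, …` (for applying binary operations). -/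
def duo {V : Type*} [Zero V] (v w : V) : ℕ → V := fun n =>
  if n = 0 then v else if n = 1 then w else 0

/-- Membership in `ADer^a(V)`: an alternating `(a+1)`-linear map which (for
`a ≥ 0`) is a derivation in its first (hence, by skew-symmetry, in each)
argument; `ADer^{-1}(V) = V`. -/
def MemADer (k : Type*) {V : Type*} [CommRing k] [CommRing V] [Algebra k V]
    (a : ℤ) (A : Op V) : Prop :=
  IsMultilinearOn k (ar a) A ∧ IsAlternatingOn (ar a) A ∧
    (0 ≤ a → ∀ (f g : V) (x : ℕ → V),
      A (consV (f * g) x) = f * A (consV g x) + g * A (consV f x))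

/-- Membership in `ADiff_1^a(V)`: an alternating `(a+1)`-linear map which (for
`a ≥ 0`) is a first-order differential operator in its first (hence in each)
argument; `ADiff_1^{-1}(V) = V`. -/
def MemADiff1 (k : Type*) {V : Type*} [CommRing k] [CommRing V] [Algebra k V]
    (a : ℤ) (A : Op V) : Prop :=
  IsMultilinearOn k (ar a) A ∧ IsAlternatingOn (ar a) A ∧
    (0 ≤ a → ∀ (f g : V) (x : ℕ → V),
      A (consV (f * g) x) =
        f * A (consV g x) + g * A (consV f x) - f * g * A (consV 1 x))

/-- `D : V → V` is a differential operator of order `≤ n` on the commutative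
algebra `V`. -/
def DiffOrderLe {V : Type*} [CommRing V] : ℕ → (V → V) → Prop
  | 0 => fun D => ∀ f x, D (f * x) = f * D x
  | n + 1 => fun D => ∀ f : V, DiffOrderLe n fun x => D (f * x) - f * D x

/-- Membership in `ADiff^a(V)`: an alternating `(a+1)`-linear map which is a
differential operator of some finite order in each argument separately
(the other arguments being fixed); `ADiff^{-1}(V) = V`. -/
def MemADiff (k : Type*) {V : Type*} [CommRing k] [CommRing V] [Algebra k V]
    (a : ℤ) (A : Op V) : Prop :=
  IsMultilinearOn k (ar a) A ∧ IsAlternatingOn (ar a) A ∧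
    ∀ i, i < ar a → ∃ n, ∀ x : ℕ → V,
      DiffOrderLe n fun v => A (Function.update x i v)

/-- The identity map `I ∈ A^0(V)`. -/
def Iop {V : Type*} : Op V := fun x => x 0

/-- The insertion `i_1 A` of the unit `1 ∈ V = A^{-1}(V)` into `A ∈ A^a(V)`;
for `a ≥ 0` this is `A(1,·,…,·)`. -/
def iUnit {V : Type*} [CommRing V] (a : ℤ) (A : Op V) : Op V :=
  nrIns (ar a) 0 A fun _ => 1

/-- Application of a degree-0 (i.e. unary) operation to an element of `V`. -/
def app1 {V : Type*} (X : Op V) (v : V) : V := X fun _ => v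

/-- The commutator `X∘Y − Y∘X` of two degree-0 operations. -/
def commOp {V : Type*} [AddCommGroup V] (X Y : Op V) : Op V := fun x =>
  app1 X (app1 Y (x 0)) - app1 Y (app1 X (x 0))

/-- The iterated wedge product `X_1 ∧ … ∧ X_m` of a list of degree-0
operations (with the empty product being the unit `1 ∈ V = A^{-1}(V)`). -/
def wedgeList {V : Type*} [CommRing V] : List (Op V) → Op V
  | [] => fun _ => 1
  | X :: l => wedge 1 l.length X (wedgeList l)


/-- Precompose the first `n` entries of a sequence with a permutation. -/
def permSeq {V : Type*} {n : ℕ} (σ : Equiv.Perm (Fin n)) (x : ℕ → V) : ℕ → V := fun i =>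
  if h : i < n then x (σ ⟨i, h⟩) else x i

/-- The sequence `x_p, x_{p+1}, …`. -/
def shift {V : Type*} (p : ℕ) (x : ℕ → V) : ℕ → V := fun i => x (p + i)

/-- The sign of a permutation, as an integer. -/
abbrev sgn {n : ℕ} (σ : Equiv.Perm (Fin n)) : ℤ := ((Equiv.Perm.sign σ : ℤˣ) : ℤ)

theorem sgn_mul_self {n : ℕ} (σ : Equiv.Perm (Fin n)) : sgn σ * sgn σ = 1 := by
  rw [sgn, ← Units.val_mul, Int.units_mul_self, Units.val_one]

theorem sgn_mul {n : ℕ} (σ τ : Equiv.Perm (Fin n)) : sgn (σ * τ) = sgn σ * sgn τ := by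
  simp [sgn]

/-- The permutation of `Fin (p + q)` acting separately on the two blocks. -/
def blockPerm {p q : ℕ} (ρ : Equiv.Perm (Fin p)) (ρ' : Equiv.Perm (Fin q)) :
    Equiv.Perm (Fin (p + q)) :=
  finSumFinEquiv.permCongr (Equiv.Perm.sumCongr ρ ρ')

section Sequences

variable {V : Type*} {n p q : ℕ}

theorem permSeq_lt (σ : Equiv.Perm (Fin n)) (x : ℕ → V) {i : ℕ} (h : i < n) :
    permSeq σ x i = x (σ ⟨i, h⟩) := dif_pos h

theorem permSeq_ge (σ : Equiv.Perm (Fin n)) (x : ℕ → V) {i : ℕ} (h : ¬ i < n) :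
    permSeq σ x i = x i := dif_neg h

theorem permSeq_mul (σ τ : Equiv.Perm (Fin n)) (x : ℕ → V) :
    permSeq (σ * τ) x = permSeq τ (permSeq σ x) := by
  funext i
  by_cases h : i < n
  · rw [permSeq_lt _ _ h, permSeq_lt _ _ h, permSeq_lt _ _ (τ ⟨i, h⟩).2]
    rfl
  · rw [permSeq_ge _ _ h, permSeq_ge _ _ h, permSeq_ge _ _ h]

theorem sgn_blockPerm (ρ : Equiv.Perm (Fin p)) (ρ' : Equiv.Perm (Fin q)) :
    sgn (blockPerm ρ ρ') = sgn ρ * sgn ρ' := by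
  simp [sgn, blockPerm, Equiv.Perm.sign_permCongr, Equiv.Perm.sign_sumCongr]

theorem blockPerm_castAdd (ρ : Equiv.Perm (Fin p)) (ρ' : Equiv.Perm (Fin q)) (i : Fin p) :
    blockPerm ρ ρ' (Fin.castAdd q i) = Fin.castAdd q (ρ i) := by
  simp [blockPerm, Equiv.permCongr_apply]

theorem blockPerm_natAdd (ρ : Equiv.Perm (Fin p)) (ρ' : Equiv.Perm (Fin q)) (i : Fin q) :
    blockPerm ρ ρ' (Fin.natAdd p i) = Fin.natAdd p (ρ' i) := by
  simp [blockPerm, Equiv.permCongr_apply]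

theorem permSeq_blockPerm_of_lt (ρ : Equiv.Perm (Fin p)) (ρ' : Equiv.Perm (Fin q))
    (x : ℕ → V) {i : ℕ} (h : i < p) : permSeq (blockPerm ρ ρ') x i = permSeq ρ x i := by
  rw [permSeq_lt _ _ (by omega : i < p + q), permSeq_lt _ _ h]
  exact congrArg (fun j : Fin (p + q) => x j) (blockPerm_castAdd ρ ρ' ⟨i, h⟩)

theorem shift_permSeq_blockPerm (ρ : Equiv.Perm (Fin p)) (ρ' : Equiv.Perm (Fin q))
    (x : ℕ → V) : shift p (permSeq (blockPerm ρ ρ') x) = permSeq ρ' (shift p x) := by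
  funext i
  by_cases h : i < q
  · rw [permSeq_lt _ _ h, shift, permSeq_lt _ _ (by omega : p + i < p + q)]
    exact congrArg (fun j : Fin (p + q) => x j) (blockPerm_natAdd ρ ρ' ⟨i, h⟩)
  · rw [permSeq_ge _ _ h, shift, permSeq_ge _ _ (by omega : ¬ p + i < p + q), shift]

theorem permSeq_one (x : ℕ → V) : permSeq (1 : Equiv.Perm (Fin n)) x = x := by
  funext i
  by_cases h : i < n
  · rw [permSeq_lt _ _ h]; rfl
  · rw [permSeq_ge _ _ h]

theorem permSeq_blockPerm_one (ρ : Equiv.Perm (Fin p)) (x : ℕ → V) :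
    permSeq (blockPerm ρ (1 : Equiv.Perm (Fin q))) x = permSeq ρ x := by
  funext i
  by_cases h : i < p
  · exact permSeq_blockPerm_of_lt _ _ _ h
  · obtain ⟨j, rfl⟩ := Nat.exists_eq_add_of_le (not_lt.mp h)
    have := congrFun (shift_permSeq_blockPerm ρ (1 : Equiv.Perm (Fin q)) x) j
    rw [permSeq_one] at this
    rw [permSeq_ge _ _ h]
    exact this

theorem shift_permSeq (ρ : Equiv.Perm (Fin p)) (x : ℕ → V) :
    shift p (permSeq ρ x) = shift p x := by
  funext i
  exact permSeq_ge _ _ (by omega)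

theorem DependsOn.permSeq {F : Op V} (hF : DependsOn n F) (σ : Equiv.Perm (Fin n)) :
    DependsOn n fun x => F (permSeq σ x) := by
  intro x y h
  refine hF _ _ fun i hi => ?_
  rw [permSeq_lt _ _ hi, permSeq_lt _ _ hi]
  exact h _ (σ ⟨i, hi⟩).2

theorem mem_Unshuffles_add {σ : Equiv.Perm (Fin (p + q))} :
    σ ∈ Unshuffles (p + q) p ↔
      StrictMono (fun i => σ (Fin.castAdd q i)) ∧ StrictMono (fun i => σ (Fin.natAdd p i)) := by
  simp only [Unshuffles, Finset.mem_filter, Finset.mem_univ, true_and]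
  constructor
  · rintro ⟨h₁, h₂⟩
    exact ⟨fun i j hij => h₁ _ _ (by simpa using hij) (by simp),
      fun i j hij => h₂ _ _ (by simpa using hij) (by simp)⟩
  · rintro ⟨h₁, h₂⟩
    refine ⟨fun i j hij hj => ?_, fun i j hij hi => ?_⟩
    · exact h₁ (show (⟨i, by omega⟩ : Fin p) < ⟨j, hj⟩ from hij)
    · have := h₂ (show (⟨i - p, by omega⟩ : Fin q) < ⟨j - p, by omega⟩ from
        Fin.mk_lt_mk.mpr (by omega))
      have e : ∀ l : Fin (p + q), p ≤ (l : ℕ) → ∀ h : (l : ℕ) - p < q,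
          Fin.natAdd p (⟨l - p, h⟩ : Fin q) = l := fun l hl h => by
        ext; simp; omega
      simpa only [e i hi, e j (by omega)] using this

/-- Every permutation factors uniquely as an unshuffle times a block permutation. -/
theorem unshuffle_mul_blockPerm_bijOn :
    Set.BijOn (fun t : Equiv.Perm (Fin (p + q)) × Equiv.Perm (Fin p) × Equiv.Perm (Fin q) =>
        t.1 * blockPerm t.2.1 t.2.2)
      (Unshuffles (p + q) p ×ˢ (Finset.univ : Finset (Equiv.Perm (Fin p) × Equiv.Perm (Fin q))) :
        Finset _) (Finset.univ : Finset (Equiv.Perm (Fin (p + q)))) := by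
  refine ⟨fun _ _ => by simp, ?_, ?_⟩
  · rintro ⟨τ, ρ, ρ'⟩ h ⟨τ₂, ρ₂, ρ₂'⟩ h₂ he
    simp only [Finset.coe_product, Set.mem_prod, Finset.mem_coe, mem_Unshuffles_add] at h h₂
    have hl : ∀ i, τ (Fin.castAdd q (ρ i)) = τ₂ (Fin.castAdd q (ρ₂ i)) := fun i => by
      simpa [blockPerm_castAdd] using Equiv.congr_fun he (Fin.castAdd q i)
    have hr : ∀ i, τ (Fin.natAdd p (ρ' i)) = τ₂ (Fin.natAdd p (ρ₂' i)) := fun i => by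
      simpa [blockPerm_natAdd] using Equiv.congr_fun he (Fin.natAdd p i)
    have el := (h.1.1.range_inj h₂.1.1).mp (by
      rw [← ρ.surjective.range_comp, ← ρ₂.surjective.range_comp (fun i => τ₂ _)]
      exact congrArg Set.range (funext hl))
    have er := (h.1.2.range_inj h₂.1.2).mp (by
      rw [← ρ'.surjective.range_comp, ← ρ₂'.surjective.range_comp (fun i => τ₂ _)]
      exact congrArg Set.range (funext hr))
    have e : τ = τ₂ := by
      ext i : 1
      induction i using Fin.addCases with
      | left i => exact congrFun el i
      | right i => exact congrFun er i
    subst e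
    have e₁ : ρ = ρ₂ := by
      ext i : 1
      simpa using hl i
    have e₂ : ρ' = ρ₂' := by
      ext i : 1
      simpa using hr i
    rw [e₁, e₂]
  · rintro σ -
    let ρ := Tuple.sort fun i => σ (Fin.castAdd q i)
    let ρ' := Tuple.sort fun i => σ (Fin.natAdd p i)
    refine ⟨⟨σ * blockPerm ρ ρ', ρ⁻¹, ρ'⁻¹⟩, ?_, ?_⟩
    · simp only [Finset.coe_product, Set.mem_prod, Finset.mem_coe, mem_Unshuffles_add,
        Finset.coe_univ, Set.mem_univ, and_true, Equiv.Perm.mul_apply, blockPerm_castAdd,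
        blockPerm_natAdd]
      exact ⟨(Tuple.monotone_sort fun i => σ (Fin.castAdd q i)).strictMono_of_injective
          (fun i j h => by simpa using h),
        (Tuple.monotone_sort fun i => σ (Fin.natAdd p i)).strictMono_of_injective
          (fun i j h => by simpa using h)⟩
    · ext i : 1
      induction i using Fin.addCases with
      | left i => simp [blockPerm_castAdd]
      | right i => simp [blockPerm_natAdd]

theorem exists_perm_swapping_blocks (m n : ℕ) :
    ∃ s : Equiv.Perm (Fin (m + n)), sgn s = (-1) ^ (m * n) ∧
      ∀ (V : Type*) (z : ℕ → V), (∀ i < m, permSeq s z i = z (n + i)) ∧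
        ∀ j < n, permSeq s z (m + j) = z j := by
  rcases hN : m + n with _ | N
  · obtain ⟨rfl, rfl⟩ : m = 0 ∧ n = 0 := by omega
    exact ⟨1, by simp [sgn], by simp⟩
  · have hpow : ∀ (r : ℕ) (i : Fin (N + 1)),
        (((finRotate (N + 1)) ^ r) i : ℕ) = (i + r) % (N + 1) := by
      intro r
      induction r with
      | zero => intro i; simp [Nat.mod_eq_of_lt i.2]
      | succ r ih =>
        intro i
        rw [pow_succ', Equiv.Perm.mul_apply, finRotate_apply, Fin.val_add, ih, Fin.val_one',
          ← Nat.add_mod, add_assoc]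
    refine ⟨finRotate (N + 1) ^ n, ?_, fun V z => ⟨fun i hi => ?_, fun j hj => ?_⟩⟩
    · have hs : sgn (finRotate (N + 1) ^ n) = (-1) ^ (N * n) := by
        simp [sgn, sign_finRotate, pow_mul]
      rw [hs]
      rcases n with _ | n
      · simp
      · obtain rfl : N = m + n := by omega
        rw [add_mul, pow_add, (Nat.even_mul_succ_self n).neg_one_pow, mul_one]
    · rw [permSeq_lt _ _ (by omega : i < N + 1), hpow, Nat.mod_eq_of_lt (by simp; omega),
        add_comm]
    · rw [permSeq_lt _ _ (by omega : m + j < N + 1), hpow]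
      congr 1
      rw [show ((⟨m + j, by omega⟩ : Fin (N + 1)) : ℕ) + n = j + (N + 1) by simp; omega,
        Nat.add_mod_right, Nat.mod_eq_of_lt (by omega)]

end Sequences

section Antisymmetrization

variable {V : Type*} [AddCommGroup V] {n p q p₁ p₂ : ℕ}

/-- The signed sum of `G` over all permutations of the first `n` arguments. -/
def altSum (n : ℕ) (G : Op V) : Op V := fun x =>
  ∑ σ : Equiv.Perm (Fin n), sgn σ • G (permSeq σ x)

/-- The signed sum of `G` over all unshuffles of the first `n` arguments. -/
def unshuffleSum (n p : ℕ) (G : Op V) : Op V := fun x =>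
  ∑ σ ∈ Unshuffles n p, sgn σ • G (permSeq σ x)

/-- `F` depends on `n` arguments and changes by the sign under their permutations. -/
def IsSkew (n : ℕ) (F : Op V) : Prop :=
  DependsOn n F ∧ ∀ (σ : Equiv.Perm (Fin n)) (x : ℕ → V), F (permSeq σ x) = sgn σ • F x

/-- `G` depends on `p + q` arguments and is skew in the first `p` and in the last `q`. -/
def IsBlockSkew (p q : ℕ) (G : Op V) : Prop :=
  DependsOn (p + q) G ∧ ∀ (ρ : Equiv.Perm (Fin p)) (ρ' : Equiv.Perm (Fin q)) (x : ℕ → V),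
    G (permSeq (blockPerm ρ ρ') x) = (sgn ρ * sgn ρ') • G x

theorem altSum_permSeq (G : Op V) (τ : Equiv.Perm (Fin n)) (x : ℕ → V) :
    altSum n G (permSeq τ x) = sgn τ • altSum n G x := by
  rw [altSum, altSum, Finset.smul_sum,
    ← Equiv.sum_comp (Equiv.mulLeft τ) fun σ => sgn τ • sgn σ • G (permSeq σ x)]
  refine Finset.sum_congr rfl fun σ _ => ?_
  rw [Equiv.coe_mulLeft, permSeq_mul, sgn_mul, smul_smul, ← mul_assoc, sgn_mul_self, one_mul]

theorem altSum_comp_permSeq (G : Op V) (τ : Equiv.Perm (Fin n)) :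
    altSum n (fun x => G (permSeq τ x)) = sgn τ • altSum n G := by
  funext x
  rw [Pi.smul_apply, altSum, altSum, Finset.smul_sum,
    ← Equiv.sum_comp (Equiv.mulRight τ) fun σ => sgn τ • sgn σ • G (permSeq σ x)]
  refine Finset.sum_congr rfl fun σ _ => ?_
  rw [Equiv.coe_mulRight, permSeq_mul, sgn_mul, smul_smul, mul_left_comm, sgn_mul_self, mul_one]

theorem altSum_nsmul (r : ℕ) (G : Op V) : altSum n (r • G) = r • altSum n G := by
  funext x
  simp only [altSum, Pi.smul_apply, Finset.smul_sum]
  exact Finset.sum_congr rfl fun σ _ => smul_comm _ _ _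

theorem altSum_zsmul (r : ℤ) (G : Op V) : altSum n (r • G) = r • altSum n G := by
  funext x
  simp only [altSum, Pi.smul_apply, Finset.smul_sum]
  exact Finset.sum_congr rfl fun σ _ => smul_comm _ _ _

theorem altSum_sum {ι : Type*} (s : Finset ι) (G : ι → Op V) :
    altSum n (fun x => ∑ i ∈ s, G i x) = ∑ i ∈ s, altSum n (G i) := by
  funext x
  simp only [altSum, Finset.sum_apply, Finset.smul_sum]
  exact Finset.sum_comm

theorem altSum_add (F G : Op V) : altSum n (F + G) = altSum n F + altSum n G := by
  funext x
  simp [altSum, Finset.sum_add_distrib]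

theorem altSum_sub (F G : Op V) : altSum n (F - G) = altSum n F - altSum n G := by
  funext x
  simp [altSum, smul_sub]

theorem altSum_eq_nsmul_unshuffleSum {G : Op V} (hG : IsBlockSkew p q G) :
    altSum (p + q) G = (p.factorial * q.factorial) • unshuffleSum (p + q) p G := by
  funext x
  have hb := unshuffle_mul_blockPerm_bijOn (p := p) (q := q)
  rw [altSum, ← Finset.sum_nbij _ hb.mapsTo hb.injOn hb.surjOn (fun _ _ => rfl),
    Finset.sum_product, Pi.smul_apply, unshuffleSum, Finset.smul_sum]
  refine Finset.sum_congr rfl fun τ _ => ?_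
  have : ∀ t ∈ (Finset.univ : Finset (Equiv.Perm (Fin p) × Equiv.Perm (Fin q))),
      sgn (τ * blockPerm t.1 t.2) • G (permSeq (τ * blockPerm t.1 t.2) x) =
        sgn τ • G (permSeq τ x) := fun t _ => by
    rw [permSeq_mul, hG.2, sgn_mul, sgn_blockPerm, smul_smul, mul_assoc, mul_mul_mul_comm,
      sgn_mul_self, sgn_mul_self, one_mul, mul_one]
  rw [Finset.sum_congr rfl this]
  simp [Fintype.card_perm]

theorem IsBlockSkew.isSkew_unshuffleSum [IsAddTorsionFree V] {G : Op V} (hG : IsBlockSkew p q G) :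
    IsSkew (p + q) (unshuffleSum (p + q) p G) := by
  refine ⟨fun x y h => Finset.sum_congr rfl fun σ _ => ?_, fun σ x => ?_⟩
  · exact congrArg (sgn σ • ·) (hG.1.permSeq σ x y h)
  · have h := altSum_permSeq G σ x
    rw [altSum_eq_nsmul_unshuffleSum hG, Pi.smul_apply, Pi.smul_apply, smul_comm] at h
    exact nsmul_right_injective (by positivity) h

theorem IsSkew.isBlockSkew_comp {F : Op V} (hF : IsSkew p F) {Φ : (ℕ → V) → V →+ V}
    (hΦ : ∀ v, IsSkew q fun z => Φ z v) :
    IsBlockSkew p q fun x => Φ (shift p x) (F x) := by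
  refine ⟨fun x y h => ?_, fun ρ ρ' x => ?_⟩
  · dsimp only
    rw [hF.1 x y fun i hi => h i (by omega)]
    exact (hΦ _).1 _ _ fun i hi => h _ (by omega)
  · dsimp only
    rw [shift_permSeq_blockPerm,
      hF.1 _ (permSeq ρ x) fun i hi => permSeq_blockPerm_of_lt ρ ρ' x hi, hF.2, map_zsmul]
    exact (congrArg (sgn ρ • ·) ((hΦ (F x)).2 ρ' (shift p x))).trans (smul_smul _ _ _)

theorem unshuffleSum_comp_unshuffleSum [IsAddTorsionFree V] {G : Op V} (hG : IsBlockSkew p₁ p₂ G)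
    {Φ : (ℕ → V) → V →+ V} (hΦ : ∀ v, IsSkew q fun z => Φ z v) :
    (p₁.factorial * p₂.factorial * q.factorial) •
        unshuffleSum (p₁ + p₂ + q) (p₁ + p₂)
          (fun x => Φ (shift (p₁ + p₂) x) (unshuffleSum (p₁ + p₂) p₁ G x)) =
      altSum (p₁ + p₂ + q) fun x => Φ (shift (p₁ + p₂) x) (G x) := by
  set p := p₁ + p₂
  have h₁ := altSum_eq_nsmul_unshuffleSum (hG.isSkew_unshuffleSum.isBlockSkew_comp hΦ)
  have h₂ : (fun x => ∑ τ : Equiv.Perm (Fin p), sgn τ •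
        Φ (shift p (permSeq (blockPerm τ (1 : Equiv.Perm (Fin q))) x))
          (G (permSeq (blockPerm τ (1 : Equiv.Perm (Fin q))) x))) =
      (p₁.factorial * p₂.factorial) •
        fun x => Φ (shift p x) (unshuffleSum p p₁ G x) := by
    funext x
    have := congrFun (altSum_eq_nsmul_unshuffleSum hG) x
    rw [Pi.smul_apply] at this ⊢
    rw [← map_nsmul, ← this, altSum, map_sum]
    refine Finset.sum_congr rfl fun τ _ => ?_
    rw [permSeq_blockPerm_one, shift_permSeq, map_zsmul]
  have h₃ := congrArg (altSum (p + q)) h₂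
  rw [altSum_nsmul, h₁, altSum_sum] at h₃
  have h₄ : ∀ τ ∈ (Finset.univ : Finset (Equiv.Perm (Fin p))),
      altSum (p + q) (fun x => sgn τ •
        Φ (shift p (permSeq (blockPerm τ (1 : Equiv.Perm (Fin q))) x))
          (G (permSeq (blockPerm τ (1 : Equiv.Perm (Fin q))) x))) =
      altSum (p + q) fun x => Φ (shift p x) (G x) := fun τ _ => by
    have := altSum_zsmul (n := p + q) (sgn τ) fun x =>
        Φ (shift p (permSeq (blockPerm τ (1 : Equiv.Perm (Fin q))) x))
          (G (permSeq (blockPerm τ (1 : Equiv.Perm (Fin q))) x))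
    refine this.trans ?_
    rw [altSum_comp_permSeq (fun x => Φ (shift p x) (G x)), sgn_blockPerm, smul_smul, ← mul_assoc,
      sgn_mul_self]
    simp [sgn]
  rw [Finset.sum_congr rfl h₄, Finset.sum_const, Finset.card_univ, Fintype.card_perm,
    Fintype.card_fin] at h₃
  refine nsmul_right_injective (Nat.factorial_ne_zero p) ?_
  dsimp only
  rw [h₃, smul_smul, smul_smul]
  congr 1
  ring

theorem IsSkew.mul_left {V : Type*} [CommRing V] {F : Op V} (hF : IsSkew n F) (v : V) :
    IsSkew n fun x => v * F x :=
  ⟨fun x y h => congrArg (v * ·) (hF.1 x y h), fun σ x => by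
    dsimp only
    rw [hF.2, mul_smul_comm]⟩

theorem IsSkew.altSum_eq {G : Op V} (hG : IsSkew n G) : altSum n G = n.factorial • G := by
  funext x
  have : ∀ σ ∈ (Finset.univ : Finset (Equiv.Perm (Fin n))), sgn σ • G (permSeq σ x) = G x :=
    fun σ _ => by rw [hG.2, smul_smul, sgn_mul_self, one_smul]
  rw [altSum, Finset.sum_congr rfl this]
  simp [Fintype.card_perm]

theorem unshuffleSum_mul_unshuffleSum {V : Type*} [CommRing V] [IsAddTorsionFree V]
    {F G : Op V} (hF : IsSkew p F) (hG : IsBlockSkew p₁ p₂ G) :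
    (p.factorial * p₁.factorial * p₂.factorial) •
        unshuffleSum (p + (p₁ + p₂)) p
          (fun x => F x * unshuffleSum (p₁ + p₂) p₁ G (shift p x)) =
      altSum (p + (p₁ + p₂)) fun x => F x * G (shift p x) := by
  set q := p₁ + p₂
  have h₁ := altSum_eq_nsmul_unshuffleSum (hF.isBlockSkew_comp (q := q)
    (Φ := fun z => AddMonoidHom.mulRight (unshuffleSum q p₁ G z)) fun v =>
      hG.isSkew_unshuffleSum.mul_left v)
  simp only [AddMonoidHom.coe_mulRight] at h₁
  have h₂ : (fun x => ∑ τ : Equiv.Perm (Fin q), sgn τ •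
        (F (permSeq (blockPerm (1 : Equiv.Perm (Fin p)) τ) x) *
          G (shift p (permSeq (blockPerm (1 : Equiv.Perm (Fin p)) τ) x)))) =
      (p₁.factorial * p₂.factorial) •
        fun x => F x * unshuffleSum q p₁ G (shift p x) := by
    funext x
    have := congrFun (altSum_eq_nsmul_unshuffleSum hG) (shift p x)
    rw [Pi.smul_apply] at this ⊢
    rw [← mul_smul_comm, ← this, altSum, Finset.mul_sum]
    refine Finset.sum_congr rfl fun τ _ => ?_
    rw [shift_permSeq_blockPerm, hF.1 _ x fun i hi => by
      rw [permSeq_blockPerm_of_lt _ _ _ hi, permSeq_one], mul_smul_comm]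
  have h₃ := congrArg (altSum (p + q)) h₂
  rw [altSum_nsmul, h₁, altSum_sum] at h₃
  have h₄ : ∀ τ ∈ (Finset.univ : Finset (Equiv.Perm (Fin q))),
      altSum (p + q) (fun x => sgn τ •
        (F (permSeq (blockPerm (1 : Equiv.Perm (Fin p)) τ) x) *
          G (shift p (permSeq (blockPerm (1 : Equiv.Perm (Fin p)) τ) x)))) =
      altSum (p + q) fun x => F x * G (shift p x) := fun τ _ => by
    have := altSum_zsmul (n := p + q) (sgn τ) fun x =>
        F (permSeq (blockPerm (1 : Equiv.Perm (Fin p)) τ) x) *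
          G (shift p (permSeq (blockPerm (1 : Equiv.Perm (Fin p)) τ) x))
    refine this.trans ?_
    rw [altSum_comp_permSeq (fun x => F x * G (shift p x)), sgn_blockPerm, smul_smul,
      mul_left_comm, sgn_mul_self]
    simp [sgn]
  rw [Finset.sum_congr rfl h₄, Finset.sum_const, Finset.card_univ, Fintype.card_perm,
    Fintype.card_fin] at h₃
  refine nsmul_right_injective (Nat.factorial_ne_zero q) ?_
  dsimp only
  rw [h₃, smul_smul, smul_smul]
  congr 1
  ring

end Antisymmetrization

section Operations

theorem isSkew_of_alternating {k V : Type*} [CommRing k] [AddCommGroup V] [Module k V] {n : ℕ}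
    {A : Op V} (hA : IsMultilinearOn k n A) (hA' : IsAlternatingOn n A) : IsSkew n A := by
  let pad (v : Fin n → V) : ℕ → V := fun i => if h : i < n then v ⟨i, h⟩ else 0
  have hpad : ∀ (v : Fin n → V) (i : Fin n) (w : V),
      A (pad (Function.update v i w)) = A (Function.update (pad v) i w) := fun v i w =>
    hA.1 _ _ fun j hj => by
      by_cases h : j = i
      · subst h; simp [pad]
      · simp [pad, hj, h, Fin.ext_iff]
  let f : V [⋀^Fin n]→ₗ[k] V :=
    { toFun := fun v => A (pad v)
      map_update_add' := fun v i a b => by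
        cases Subsingleton.elim ‹DecidableEq (Fin n)› (instDecidableEqFin n)
        simp only [hpad, (hA.2 i i.2).2]
      map_update_smul' := fun v i c a => by
        cases Subsingleton.elim ‹DecidableEq (Fin n)› (instDecidableEqFin n)
        simp only [hpad, (hA.2 i i.2).1]
      map_eq_zero_of_eq' := fun v i j hv hij =>
        hA' _ i j i.2 j.2 (by simpa [Fin.ext_iff] using hij) (by simpa [pad] using hv) }
  have hf : ∀ x, A x = f fun i => x i := fun x => hA.1 _ _ fun i hi => by simp [pad, hi]
  refine ⟨hA.1, fun σ x => ?_⟩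
  rw [hf, hf]
  have h := f.map_perm (fun i => x i) σ
  rw [Units.smul_def] at h
  rw [← h]
  congr 1
  funext i
  exact permSeq_lt σ x i.2

theorem update_consV_succ {V : Type*} (v w : V) (x : ℕ → V) (i : ℕ) :
    Function.update (consV v x) (i + 1) w = consV v (Function.update x i w) := by
  funext j
  rcases j with _ | j <;> simp [consV, Function.update_apply]

theorem update_consV_zero {V : Type*} (v w : V) (x : ℕ → V) :
    Function.update (consV v x) 0 w = consV w x := by
  funext j
  rcases j with _ | j <;> simp [consV]

theorem consV_congr {V : Type*} {m : ℕ} {C : Op V} (hC : DependsOn (m + 1) C) (v : V)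
    {x y : ℕ → V} (h : ∀ i < m, x i = y i) : C (consV v x) = C (consV v y) :=
  hC _ _ fun i hi => by
    rcases i with _ | i
    · rfl
    · exact h i (by omega)

theorem isSkew_consV {k V : Type*} [CommRing k] [AddCommGroup V] [Module k V] {m : ℕ}
    {C : Op V} (hC : IsMultilinearOn k (m + 1) C) (hC' : IsAlternatingOn (m + 1) C) (v : V) :
    IsSkew m fun x => C (consV v x) := by
  refine isSkew_of_alternating (k := k) ⟨fun x y h => consV_congr hC.1 v h, fun i hi => ?_⟩ ?_
  · simp only [← update_consV_succ]
    exact ⟨fun x => (hC.2 (i + 1) (by omega)).1 _, fun x => (hC.2 (i + 1) (by omega)).2 _⟩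
  · exact fun x i j hi hj hij h =>
      hC' _ (i + 1) (j + 1) (by omega) (by omega) (by omega) (by simpa [consV] using h)

theorem wedge_eq_unshuffleSum {V : Type*} [CommRing V] {p q : ℕ} {A B : Op V}
    (hA : DependsOn p A) (hB : DependsOn q B) :
    wedge p q A B = unshuffleSum (p + q) p fun x => A x * B (shift p x) := by
  funext x
  refine Finset.sum_congr rfl fun σ _ => ?_
  congr 2
  · refine hA _ _ fun i hi => ?_
    rw [dif_pos hi, permSeq_lt _ _ (by omega)]
  · refine hB _ _ fun i hi => ?_
    rw [dif_pos hi, shift, permSeq_lt _ _ (by omega)]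

theorem nrIns_eq_unshuffleSum {V : Type*} [AddCommGroup V] {m p : ℕ} {C A : Op V}
    (hC : DependsOn (m + 1) C) (hA : DependsOn p A) :
    nrIns (m + 1) p C A = unshuffleSum (p + m) p fun x => C (consV (A x) (shift p x)) := by
  funext x
  rw [nrIns, dif_neg (Nat.succ_ne_zero m), unshuffleSum]
  have hN : m + 1 + p - 1 = p + m := by omega
  have key : ∀ (N : ℕ) (hN : N = p + m) (h₁ : ∀ i < p, i < N)
      (h₂ : ∀ j, j ≠ 0 → j < m + 1 → p + j - 1 < N),
      (∑ σ ∈ Unshuffles N p, sgn σ • C fun j =>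
          if hj0 : j = 0 then A fun i => if hi : i < p then x (σ ⟨i, h₁ i hi⟩) else 0
          else if hj : j < m + 1 then x (σ ⟨p + j - 1, h₂ j hj0 hj⟩) else 0) =
        ∑ σ ∈ Unshuffles (p + m) p,
          sgn σ • C (consV (A (permSeq σ x)) (shift p (permSeq σ x))) := by
    rintro N rfl h₁ h₂
    refine Finset.sum_congr rfl fun σ _ => ?_
    congr 1
    refine hC _ _ fun j hj => ?_
    rcases j with _ | j
    · simp only [consV, dite_true, if_true]
      refine hA _ _ fun i hi => ?_
      rw [dif_pos hi, permSeq_lt _ _ (h₁ i hi)]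
    · rw [dif_neg (Nat.succ_ne_zero j), dif_pos hj]
      simp only [consV, shift, Nat.succ_ne_zero, if_false, Nat.add_sub_cancel]
      rw [permSeq_lt _ _ (by omega)]
      rfl
  exact key _ hN (fun i hi => by omega) (fun j h₀ hj => by omega)

theorem nrIns_one {k V : Type*} [CommRing k] [CommRing V] [Module k V] [IsAddTorsionFree V]
    {m : ℕ} {C : Op V} (hC : IsMultilinearOn k (m + 1) C) (hC' : IsAlternatingOn (m + 1) C) :
    nrIns (m + 1) 0 C (fun _ => 1) = fun x => C (consV 1 x) := by
  have hs : ∀ x : ℕ → V, shift 0 x = x := fun x => funext fun i => by simp [shift]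
  rw [nrIns_eq_unshuffleSum hC.1 fun _ _ _ => rfl]
  simp only [hs]
  have hG := isSkew_consV hC hC' (1 : V)
  have hb : IsBlockSkew 0 m fun x => C (consV 1 x) := by
    refine ⟨by simpa using hG.1, fun ρ ρ' x => ?_⟩
    rw [← hs (permSeq _ x), shift_permSeq_blockPerm, hs]
    simpa [sgn, Subsingleton.elim ρ 1] using hG.2 ρ' x
  have h := altSum_eq_nsmul_unshuffleSum hb
  have hG' : IsSkew (0 + m) fun x => C (consV 1 x) := by rwa [zero_add]
  rw [hG'.altSum_eq, Nat.factorial_zero, one_mul, zero_add] at h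
  rw [zero_add]
  exact (nsmul_right_injective (Nat.factorial_ne_zero m) h).symm

theorem shift_shift {V : Type*} (p q : ℕ) (x : ℕ → V) :
    shift q (shift p x) = shift (p + q) x := by
  funext i
  simp [shift, add_assoc]

/-- Moving `q` arguments past a block of `m` arguments changes the antisymmetrization by
the sign `(-1) ^ (m * q)`. -/
theorem altSum_swap_blocks {V : Type*} [AddCommGroup V] (p m q : ℕ)
    {F : (ℕ → V) → (ℕ → V) → (ℕ → V) → V}
    (hF : ∀ x x' y y' z z', (∀ i < p, x i = x' i) → (∀ i < m, y i = y' i) →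
      (∀ i < q, z i = z' i) → F x y z = F x' y' z') :
    altSum (p + q + m) (fun x => F x (shift (p + q) x) (shift p x)) =
      ((-1 : ℤ) ^ (m * q)) •
        altSum (p + m + q) fun x => F x (shift p x) (shift (p + m) x) := by
  obtain ⟨s, hs, hperm⟩ := exists_perm_swapping_blocks m q
  have h := altSum_comp_permSeq (fun x => F x (shift p x) (shift (p + m) x))
    (blockPerm (1 : Equiv.Perm (Fin p)) s)
  rw [sgn_blockPerm, hs] at h
  rw [show p + q + m = p + (m + q) by ring, add_assoc p m q]
  simp only [sgn, map_one, Units.val_one, one_mul] at h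
  rw [← h]
  congr 1
  funext x
  refine hF _ _ _ _ _ _ (fun i hi => ?_) (fun i hi => ?_) fun i hi => ?_
  · rw [permSeq_blockPerm_of_lt _ _ _ hi, permSeq_one]
  · rw [shift_permSeq_blockPerm, (hperm V _).1 i hi, shift, shift, add_assoc]
  · rw [← shift_shift, shift_permSeq_blockPerm]
    exact ((hperm V _).2 i hi).symm

theorem nrIns_wedge {k V : Type*} [CommRing k] [CommRing V] [Module k V] [IsAddTorsionFree V]
    {p q m : ℕ} {A B C : Op V} (hA : IsSkew p A) (hB : IsSkew q B)
    (hC : IsMultilinearOn k (m + 1) C) (hC' : IsAlternatingOn (m + 1) C)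
    (hC₁ : ∀ (f g : V) (x : ℕ → V), C (consV (f * g) x) =
      f * C (consV g x) + g * C (consV f x) - f * g * C (consV 1 x)) :
    nrIns (m + 1) (p + q) C (wedge p q A B) =
      ((-1 : ℤ) ^ (m * q)) • wedge (p + m) q (nrIns (m + 1) p C A) B +
        wedge p (q + m) A (nrIns (m + 1) q C B) -
        wedge (p + q) m (wedge p q A B) (nrIns (m + 1) 0 C fun _ => 1) := by
  let Φ : (ℕ → V) → V →+ V := fun z =>
    AddMonoidHom.mk' (fun v => C (consV v z)) fun v w => by
      simpa only [update_consV_zero] using (hC.2 0 m.succ_pos).2 (consV 0 z) v w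
  have hΦ : ∀ v, IsSkew m fun z => Φ z v := isSkew_consV hC hC'
  have hAB : IsBlockSkew p q fun x => A x * B (shift p x) :=
    hA.isBlockSkew_comp (Φ := fun z => AddMonoidHom.mulRight (B z)) hB.mul_left
  have hCA : IsBlockSkew p m fun x => C (consV (A x) (shift p x)) := hA.isBlockSkew_comp hΦ
  have hCB : IsBlockSkew q m fun x => C (consV (B x) (shift q x)) := hB.isBlockSkew_comp hΦ
  have hC1 := isSkew_consV hC hC' (1 : V)
  have t₁ := unshuffleSum_comp_unshuffleSum hAB hΦ
  have t₂ := unshuffleSum_comp_unshuffleSum hCA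
    (Φ := fun z => AddMonoidHom.mulRight (B z)) hB.mul_left
  have t₃ := unshuffleSum_mul_unshuffleSum hA hCB
  have t₄ := unshuffleSum_comp_unshuffleSum hAB
    (Φ := fun z => AddMonoidHom.mulRight (C (consV 1 z))) hC1.mul_left
  have hsw := altSum_swap_blocks p m q (F := fun x y z => C (consV (A x) y) * B z)
    fun x x' y y' z z' hx hy hz => by
      rw [hA.1 x x' hx, hB.1 z z' hz, consV_congr hC.1 _ hy]
  rw [nrIns_one hC hC', wedge_eq_unshuffleSum hA.1 hB.1,
    nrIns_eq_unshuffleSum hC.1 hAB.isSkew_unshuffleSum.1, nrIns_eq_unshuffleSum hC.1 hA.1,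
    nrIns_eq_unshuffleSum hC.1 hB.1, wedge_eq_unshuffleSum hCA.isSkew_unshuffleSum.1 hB.1,
    wedge_eq_unshuffleSum hA.1 hCB.isSkew_unshuffleSum.1,
    wedge_eq_unshuffleSum hAB.isSkew_unshuffleSum.1 hC1.1]
  refine nsmul_right_injective
    (by positivity : p.factorial * q.factorial * m.factorial ≠ 0) ?_
  rw [mul_right_comm] at t₂
  simp only [Φ, AddMonoidHom.mk'_apply, AddMonoidHom.coe_mulRight] at t₁ t₂ t₃ t₄
  dsimp only
  rw [nsmul_sub, nsmul_add, smul_comm _ ((-1 : ℤ) ^ (m * q)), t₁, t₂, t₃, t₄, ← hsw,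
    ← add_assoc p q m, ← altSum_add, ← altSum_sub]
  congr 1
  funext x
  simp only [Pi.add_apply, Pi.sub_apply, shift_shift, hC₁]
  ring

end Operations

/-- the insertion identity
`i_{A∧B}C = (−1)^{c(b+1)}(i_A C)∧B + A∧(i_B C) − A∧B∧(i_1 C)` for alternating
`A`, `B` and a first-order multidifferential operator `C`. -/
theorem statement11 (k V : Type*) [Field k] [CharZero k]
    [CommRing V] [Algebra k V]
    (a b c : ℤ) (ha : -1 ≤ a) (hb : -1 ≤ b) (hc : -1 ≤ c)
    (A B : Op V) (hA : MemA k a A) (hB : MemA k b B)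
    (C : Op V) (hC : MemADiff1 k c C) :
    nrIns (ar c) (ar (a + b + 1)) C (wedge (ar a) (ar b) A B) =
      (((-1 : ℤˣ) ^ (c * (b + 1)) : ℤˣ) : ℤ) •
          wedge (ar (a + c)) (ar b) (nrIns (ar c) (ar a) C A) B +
        wedge (ar a) (ar (b + c)) A (nrIns (ar c) (ar b) C B) -
        wedge (ar (a + b + 1)) (ar (c - 1)) (wedge (ar a) (ar b) A B) (iUnit c C) := by
  let _ : Module ℚ V := Module.compHom V (algebraMap ℚ k)
  have _ : IsAddTorsionFree V := .of_module_rat V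
  obtain ⟨p, rfl⟩ : ∃ p : ℕ, a = p - 1 := ⟨(a + 1).toNat, by omega⟩
  obtain ⟨q, rfl⟩ : ∃ q : ℕ, b = q - 1 := ⟨(b + 1).toNat, by omega⟩
  rcases hc.eq_or_lt with rfl | hc
  · funext x
    simp [nrIns, wedge, ar, iUnit]
  obtain ⟨m, rfl⟩ : ∃ m : ℕ, c = m := ⟨c.toNat, by omega⟩
  obtain ⟨hC, hC', hC₁⟩ := hC
  have hm : ar (m : ℤ) = m + 1 := by simp only [ar]; omega
  have hp : ar ((p : ℤ) - 1) = p := by simp [ar]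
  have hq : ar ((q : ℤ) - 1) = q := by simp [ar]
  rw [MemA, hp] at hA
  rw [MemA, hq] at hB
  rw [hm] at hC hC'
  rw [iUnit, hp, hq, hm, show ar ((p : ℤ) - 1 + (q - 1) + 1) = p + q by simp only [ar]; omega,
    show ar ((p : ℤ) - 1 + m) = p + m by simp only [ar]; omega,
    show ar ((q : ℤ) - 1 + m) = q + m by simp only [ar]; omega,
    show ar ((m : ℤ) - 1) = m by simp [ar],
    show (((-1 : ℤˣ) ^ ((m : ℤ) * (q - 1 + 1)) : ℤˣ) : ℤ) = (-1) ^ (m * q) by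
      rw [sub_add_cancel, ← Nat.cast_mul, zpow_natCast]; simp]
  exact nrIns_wedge (isSkew_of_alternating hA.1 hA.2) (isSkew_of_alternating hB.1 hB.2) hC hC'
    (hC₁ (by omega))

end JacobiRevisited
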